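/- Fix a real number d > 3 and for α > 0 define η₁*(α) = (−(d−3) + √((d−3)² + 4α²)) / (2α). Then η₁* is strictly increasing on (0, ∞), and 0 < η₁*(α) < 1 for all α > 0. -/

import Mathlib

open Real

/-- The peak lies in `(0,1)` and satisfies the critical point equation. -/
lemma peak_aux (c : ℝ) (hc : 0 < c) (a : ℝ) (ha : 0 < a) :
    0 < (-c + Real.sqrt (c ^ 2 + 4 * a ^ 2)) / (2 * a) ∧
    (-c + Real.sqrt (c ^ 2 + 4 * a ^ 2)) / (2 * a) < 1 ∧
    a * (1 - ((-c + Real.sqrt (c ^ 2 + 4 * a ^ 2)) / (2 * a)) ^ 2) =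
      c * ((-c + Real.sqrt (c ^ 2 + 4 * a ^ 2)) / (2 * a)) := by
  have hs : Real.sqrt (c ^ 2 + 4 * a ^ 2) ^ 2 = c ^ 2 + 4 * a ^ 2 :=
    Real.sq_sqrt (by positivity)
  have h1 : c < Real.sqrt (c ^ 2 + 4 * a ^ 2) :=
    Real.lt_sqrt_of_sq_lt (by nlinarith [mul_pos ha ha])
  have h2 : Real.sqrt (c ^ 2 + 4 * a ^ 2) < c + 2 * a := by
    rw [Real.sqrt_lt' (by positivity)]
    nlinarith [mul_pos hc ha]
  generalize Real.sqrt (c ^ 2 + 4 * a ^ 2) = s at *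
  refine ⟨div_pos (by linarith) (by linarith), ?_, ?_⟩
  · rw [div_lt_one (by linarith)]
    linarith
  · field_simp
    linear_combination (-1) * hs

/-- For fixed `d > 3`, the peak `η₁*(α) = (−(d−3) + √((d−3)² + 4α²))/(2α)` is a
strictly increasing function of `α` on `(0, ∞)`, and `0 < η₁*(α) < 1` for all `α > 0`. -/
theorem cosscale_peak_strictMono (d : ℝ) (hd : 3 < d) :
    StrictMonoOn
      (fun α : ℝ => (-(d - 3) + Real.sqrt ((d - 3) ^ 2 + 4 * α ^ 2)) / (2 * α))
      (Set.Ioi 0) ∧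
    ∀ α : ℝ, 0 < α →
      0 < (-(d - 3) + Real.sqrt ((d - 3) ^ 2 + 4 * α ^ 2)) / (2 * α) ∧
      (-(d - 3) + Real.sqrt ((d - 3) ^ 2 + 4 * α ^ 2)) / (2 * α) < 1 := by
  have hc : 0 < d - 3 := by linarith
  refine ⟨?_, fun a ha => ⟨(peak_aux _ hc a ha).1, (peak_aux _ hc a ha).2.1⟩⟩
  intro a ha b hb hab
  obtain ⟨hx0, hx1, hx⟩ := peak_aux _ hc a ha
  obtain ⟨hy0, hy1, hy⟩ := peak_aux _ hc b hb
  have ha' : 0 < a := ha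
  show (-(d - 3) + Real.sqrt ((d - 3) ^ 2 + 4 * a ^ 2)) / (2 * a) <
    (-(d - 3) + Real.sqrt ((d - 3) ^ 2 + 4 * b ^ 2)) / (2 * b)
  generalize (-(d - 3) + Real.sqrt ((d - 3) ^ 2 + 4 * a ^ 2)) / (2 * a) = x at *
  generalize (-(d - 3) + Real.sqrt ((d - 3) ^ 2 + 4 * b ^ 2)) / (2 * b) = y at *
  by_contra! h
  have e1 : (d - 3) * y ≤ (d - 3) * x := mul_le_mul_of_nonneg_left h hc.le
  have e2 : a * (1 - x ^ 2) ≤ a * (1 - y ^ 2) :=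
    mul_le_mul_of_nonneg_left (by nlinarith) ha'.le
  have e3 : a * (1 - y ^ 2) < b * (1 - y ^ 2) :=
    mul_lt_mul_of_pos_right hab (by nlinarith)
  linarith
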